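/- For every n ≥ 2 and every identity u ≈ v over any alphabet of variables X, the hypoplactic monoid hypo satisfies u ≈ v if and only if the hypoplactic monoid hypo_n of rank n satisfies u ≈ v; that is, hypo and hypo_n satisfy exactly the same identities. -/

import Mathlib

open FreeMonoid

/-- The alphabet `A = {1 < 2 < 3 < ...}` of positive integers. -/
abbrev Alph : Type := ℕ+

/-- The finite alphabet `A_n = {1 < ... < n}`. -/
abbrev AlphN (n : ℕ) : Type := {a : ℕ+ // (a : ℕ) ≤ n}

/-- The defining relations of the hypoplactic monoid. -/
def HypoRel (u v : FreeMonoid Alph) : Prop :=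
  (∃ a b c : Alph, a ≤ b ∧ b < c ∧
      u = of a * of c * of b ∧ v = of c * of a * of b) ∨
  (∃ a b c : Alph, a < b ∧ b ≤ c ∧
      u = of b * of a * of c ∧ v = of b * of c * of a) ∨
  (∃ a b c d : Alph, a ≤ b ∧ b < c ∧ c ≤ d ∧
      u = of c * of a * of d * of b ∧ v = of a * of c * of b * of d) ∨
  (∃ a b c d : Alph, a < b ∧ b ≤ c ∧ c < d ∧
      u = of b * of d * of a * of c ∧ v = of d * of b * of c * of a)

/-- The hypoplactic congruence on `A*`: the congruence generated by `HypoRel`. -/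
def hypoCon : Con (FreeMonoid Alph) := conGen HypoRel

/-- The infinite-rank hypoplactic monoid `hypo`. -/
abbrev Hypo : Type := hypoCon.Quotient

/-- The inclusion of `A_n*` into `A*`. -/
def inclN (n : ℕ) : FreeMonoid (AlphN n) →* FreeMonoid Alph :=
  FreeMonoid.map Subtype.val

/-- The hypoplactic congruence restricted to `A_n*`. -/
def hypoConN (n : ℕ) : Con (FreeMonoid (AlphN n)) :=
  hypoCon.comap (inclN n) (fun x y => map_mul (inclN n) x y)

/-- The rank-`n` hypoplactic monoid `hypo_n`. -/
abbrev HypoN (n : ℕ) : Type := (hypoConN n).Quotient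

/-- The letter `1` of `A_2`. -/
def a1 : AlphN 2 := ⟨1, by norm_num⟩

/-- The letter `2` of `A_2`. -/
def a2 : AlphN 2 := ⟨2, by norm_num⟩

/-- The homomorphism `φ_{ij} : A* → hypo_2`, sending `i ↦ [1]`, `j ↦ [2]`,
`a ↦ [21]` for `i < a < j`, and every other letter to the identity. -/
def phi (i j : Alph) : FreeMonoid Alph →* HypoN 2 :=
  FreeMonoid.lift fun a =>
    if a = i then (hypoConN 2).mk' (of a1)
    else if a = j then (hypoConN 2).mk' (of a2)
    else if i < a ∧ a < j then (hypoConN 2).mk' (of a2 * of a1)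
    else 1

/-- A monoid `M` satisfies the identity `u ≈ v` (over the alphabet of variables `X`)
if every homomorphic evaluation of the two words in `M` gives equal values. -/
def MSatisfies (M : Type*) [Monoid M] {X : Type*} (u v : FreeMonoid X) : Prop :=
  ∀ ψ : FreeMonoid X →* M, ψ u = ψ v

/-- An identity `u ≈ v` is balanced if every variable occurs the same number of
times in `u` as in `v`. -/
def IsBalanced {X : Type*} [DecidableEq X] (u v : FreeMonoid X) : Prop :=
  ∀ x : X, u.toList.count x = v.toList.count x

/-- The class in `hypo` of a word given as a list of letters. -/
def hypoClass (w : List Alph) : Hypo := hypoCon.mk' (ofList w)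

/-- The class in `hypo` of a single letter. -/
def hypoLetter (a : Alph) : Hypo := hypoCon.mk' (of a)

lemma hypoClass_nil : hypoClass [] = 1 := rfl

lemma hypoClass_cons (a : Alph) (w : List Alph) :
    hypoClass (a :: w) = hypoLetter a * hypoClass w := rfl

lemma hypoClass_append (u v : List Alph) :
    hypoClass (u ++ v) = hypoClass u * hypoClass v := rfl

lemma mk_eq_of_hypoRel {u v : FreeMonoid Alph} (h : HypoRel u v) :
    hypoCon.mk' u = hypoCon.mk' v :=
  (Con.eq _).2 (ConGen.Rel.of _ _ h)

lemma hypoLetter_acb {a b c : Alph} (hab : a ≤ b) (hbc : b < c) (t : Hypo) :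
    hypoLetter a * (hypoLetter c * (hypoLetter b * t)) =
      hypoLetter c * (hypoLetter a * (hypoLetter b * t)) := by
  have h := mk_eq_of_hypoRel (Or.inl ⟨a, b, c, hab, hbc, rfl, rfl⟩)
  simp only [map_mul] at h
  simpa only [hypoLetter, mul_assoc] using congrArg (· * t) h

lemma hypoLetter_bac {a b c : Alph} (hab : a < b) (hbc : b ≤ c) (t : Hypo) :
    hypoLetter b * (hypoLetter a * (hypoLetter c * t)) =
      hypoLetter b * (hypoLetter c * (hypoLetter a * t)) := by
  have h := mk_eq_of_hypoRel (Or.inr (Or.inl ⟨a, b, c, hab, hbc, rfl, rfl⟩))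
  simp only [map_mul] at h
  simpa only [hypoLetter, mul_assoc] using congrArg (· * t) h

lemma hypoLetter_cadb {a b c d : Alph} (hab : a ≤ b) (hbc : b < c) (hcd : c ≤ d) (t : Hypo) :
    hypoLetter c * (hypoLetter a * (hypoLetter d * (hypoLetter b * t))) =
      hypoLetter a * (hypoLetter c * (hypoLetter b * (hypoLetter d * t))) := by
  have h := mk_eq_of_hypoRel
    (Or.inr (Or.inr (Or.inl ⟨a, b, c, d, hab, hbc, hcd, rfl, rfl⟩)))
  simp only [map_mul] at h
  simpa only [hypoLetter, mul_assoc] using congrArg (· * t) h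

lemma hypoLetter_bdac {a b c d : Alph} (hab : a < b) (hbc : b ≤ c) (hcd : c < d) (t : Hypo) :
    hypoLetter b * (hypoLetter d * (hypoLetter a * (hypoLetter c * t))) =
      hypoLetter d * (hypoLetter b * (hypoLetter c * (hypoLetter a * t))) := by
  have h := mk_eq_of_hypoRel
    (Or.inr (Or.inr (Or.inr ⟨a, b, c, d, hab, hbc, hcd, rfl, rfl⟩)))
  simp only [map_mul] at h
  simpa only [hypoLetter, mul_assoc] using congrArg (· * t) h

/-- Split a list at the first element satisfying a predicate. -/
lemma exists_first_split {α : Type*} (P : α → Prop) (w : List α) (h : ∃ x ∈ w, P x) :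
    ∃ p z r, w = p ++ z :: r ∧ (∀ y ∈ p, ¬ P y) ∧ P z := by
  induction w with
  | nil => simp at h
  | cons a w ih =>
    by_cases ha : P a
    · exact ⟨[], a, w, rfl, by simp, ha⟩
    · obtain ⟨p, z, r, rfl, hp, hz⟩ := ih (by simpa [ha] using h)
      exact ⟨a :: p, z, r, rfl, by simpa [ha] using hp, hz⟩

/-- Split a list at the last element satisfying a predicate. -/
lemma exists_last_split {α : Type*} (P : α → Prop) (w : List α) (h : ∃ x ∈ w, P x) :
    ∃ p z r, w = p ++ z :: r ∧ (∀ y ∈ r, ¬ P y) ∧ P z := by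
  obtain ⟨p, z, r, hw, hp, hz⟩ := exists_first_split P w.reverse (by simpa using h)
  refine ⟨r.reverse, z, p.reverse, ?_, by simpa using hp, hz⟩
  rw [← List.reverse_reverse w, hw]
  simp

/-- A letter `b` may be moved left across a block of letters smaller than `q ≤ b`, if `q`
directly precedes the block. -/
lemma hypoLetter_move_left (p : List Alph) (q b : Alph) (hp : ∀ t ∈ p, t < q) (hqb : q ≤ b)
    (r : Hypo) :
    hypoLetter q * (hypoClass p * (hypoLetter b * r)) =
      hypoLetter q * (hypoLetter b * (hypoClass p * r)) := by
  induction hn : p.length using Nat.strong_induction_on generalizing p q b r with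
  | _ n ih =>
  match p with
  | [] => simp [hypoClass_nil]
  | t :: p' =>
    have htq : t < q := hp t (by simp)
    by_cases hsmall : ∀ s ∈ p', s < t
    · rw [hypoClass_cons, mul_assoc, mul_assoc,
        ih p'.length (by simp [← hn]) p' t b hsmall (htq.le.trans hqb) r rfl,
        hypoLetter_bac htq hqb]
    · obtain ⟨p₁, s, p₂, rfl, hp₁, hts⟩ := exists_first_split (fun s => t ≤ s) p'
        (by simpa using hsmall)
      have hsq : s < q := hp s (by simp)
      have hfront : ∀ r', hypoLetter t * (hypoClass p₁ * (hypoLetter s * r')) =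
          hypoLetter t * (hypoLetter s * (hypoClass p₁ * r')) := fun r' =>
        ih p₁.length (by simp [← hn]) p₁ t s (fun y hy => not_le.1 (hp₁ y hy)) hts r' rfl
      have hrest := ih (s :: (p₁ ++ p₂)).length (by simp [← hn]) (s :: (p₁ ++ p₂)) q b
        (fun y hy => hp y (by simp at hy ⊢; tauto)) hqb r rfl
      simp only [hypoClass_cons, hypoClass_append, mul_assoc] at hrest ⊢
      rw [hfront, hfront, ← hypoLetter_acb hts hsq, hrest, ← hypoLetter_bac hsq hqb,
        ← hypoLetter_cadb hts hsq hqb, hypoLetter_bac htq hqb]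

/-- The letters `x < y` commute if they are followed by a block of letters smaller than `x` and
a letter in `[x, y)`. -/
lemma hypoLetter_comm_of_block (p : List Alph) (x y z : Alph) (hp : ∀ t ∈ p, t < x)
    (hxz : x ≤ z) (hzy : z < y) (r : Hypo) :
    hypoLetter x * (hypoLetter y * (hypoClass p * (hypoLetter z * r))) =
      hypoLetter y * (hypoLetter x * (hypoClass p * (hypoLetter z * r))) := by
  induction hn : p.length using Nat.strong_induction_on generalizing p r with
  | _ n ih =>
  match p with
  | [] => simpa [hypoClass_nil] using hypoLetter_acb hxz hzy r
  | q :: p' =>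
    have hqx : q < x := hp q (by simp)
    have hxy : x < y := hxz.trans_lt hzy
    by_cases hsmall : ∀ s ∈ p', s < q
    · simp only [hypoClass_cons, mul_assoc]
      rw [hypoLetter_move_left p' q z hsmall (hqx.le.trans hxz), hypoLetter_bdac hqx hxz hzy,
        hypoLetter_bac hqx hxz]
    · obtain ⟨p₁, b, p₂, rfl, hp₁, hqb⟩ := exists_first_split (fun s => q ≤ s) p'
        (by simpa using hsmall)
      have hbx : b < x := hp b (by simp)
      have hrest := ih (b :: (p₁ ++ p₂)).length (by simp [← hn]) (b :: (p₁ ++ p₂))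
        (fun y hy => hp y (by simp at hy ⊢; tauto)) r rfl
      simp only [hypoClass_cons, hypoClass_append, mul_assoc] at hrest ⊢
      rw [hypoLetter_move_left p₁ q b (fun y hy => not_le.1 (hp₁ y hy)) hqb,
        ← hypoLetter_bac hqx hxy.le, hypoLetter_cadb hqb hbx hxy.le,
        hypoLetter_bac hbx hxy.le, hrest, ← hypoLetter_acb hqb hbx,
        ← hypoLetter_acb hqx.le hxy]

/-- A letter `m` larger than all others may be moved left across the block `s` if the word after
it contains an upper bound `l` of `s`. -/
lemma hypoClass_move_max_left (s P : List Alph) (m l : Alph) (hP : ∀ t ∈ P, t < m)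
    (hl : l ∈ P) (hs : ∀ t ∈ s, t ≤ l) :
    hypoClass (s ++ m :: P) = hypoClass (m :: (s ++ P)) := by
  induction s with
  | nil => rfl
  | cons x s ih =>
    have hs' : ∀ t ∈ s, t ≤ l := fun t ht => hs t (by simp [ht])
    obtain ⟨p, z, r, hsplit, hp, hz⟩ := exists_first_split (fun t => x ≤ t) (s ++ P)
      ⟨l, by simp [hl], hs x (by simp)⟩
    have hzm : z < m := by
      have : z ∈ s ++ P := by simp [hsplit]
      rcases List.mem_append.1 this with h | h
      · exact (hs' z h).trans_lt (hP l hl)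
      · exact hP z h
    rw [List.cons_append, hypoClass_cons, ih hs', List.cons_append, hsplit]
    simp only [hypoClass_cons, hypoClass_append]
    exact hypoLetter_comm_of_block p x m z (fun t ht => not_le.1 (hp t ht)) hz hzm _

/-- The largest letter `m` commutes with a following letter `a` if a letter greater than `a`
occurs before them. -/
lemma hypoClass_swap_max (s : List Alph) (a m : Alph) (hs : ∀ t ∈ s, t ≤ m)
    (h : ∃ z ∈ s, a < z) (r : List Alph) :
    hypoClass (s ++ m :: a :: r) = hypoClass (s ++ a :: m :: r) := by
  obtain ⟨p, z, p₂, rfl, hp₂, hz⟩ := exists_last_split (fun t => a < t) s h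
  have hp₂' : ∀ t ∈ p₂, t < z := fun t ht => (not_lt.1 (hp₂ t ht)).trans_lt hz
  have hzm : z ≤ m := hs z (by simp)
  have hblock := hypoLetter_move_left (p₂ ++ [a]) z m
    (by intro t ht; simp at ht; rcases ht with ht | rfl; exacts [hp₂' t ht, hz]) hzm (hypoClass r)
  simp only [hypoClass_append, hypoClass_cons, hypoClass_nil, mul_one, mul_assoc] at hblock ⊢
  rw [hblock, hypoLetter_move_left p₂ z m hp₂' hzm]

lemma hypoClass_move_max_right (s t : List Alph) (m : Alph) (hs : ∀ c ∈ s, c ≤ m)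
    (ht : ∀ c ∈ t, c = m ∨ c < m ∧ ∃ z ∈ s, c < z) :
    hypoClass (s ++ m :: t) = hypoClass (s ++ t ++ [m]) := by
  induction t generalizing s with
  | nil => simp
  | cons c t ih =>
    have hcm : c ≤ m := by rcases ht c (by simp) with h | h; exacts [h.le, h.1.le]
    have hswap : hypoClass (s ++ m :: c :: t) = hypoClass (s ++ c :: m :: t) := by
      rcases ht c (by simp) with rfl | ⟨-, h⟩
      · rfl
      · exact hypoClass_swap_max s c m hs h t
    have := ih (s ++ [c]) (by intro d hd; simp at hd; rcases hd with hd | rfl; exacts [hs d hd, hcm])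
      (fun d hd => (ht d (by simp [hd])).imp_right fun ⟨h, z, hz, h'⟩ => ⟨h, z, by simp [hz], h'⟩)
    rw [hswap]
    simpa using this

/-- All occurrences of the largest letter `m` in `t` may be collected at the end, if each smaller
letter of `t` is exceeded by some letter of the prefix `s`. -/
lemma hypoClass_collect_max (s t : List Alph) (m : Alph) (hs : ∀ c ∈ s, c ≤ m)
    (ht : ∀ c ∈ t, c = m ∨ c < m ∧ ∃ z ∈ s, c < z) :
    hypoClass (s ++ t) =
      hypoClass (s ++ t.filter (· ≠ m) ++ List.replicate (t.count m) m) := by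
  induction t generalizing s with
  | nil => simp
  | cons c t ih =>
    by_cases hcm : c = m
    · subst hcm
      have ht' := fun d hd => ht d (List.mem_cons_of_mem c hd)
      rw [hypoClass_move_max_right s t c hs ht', hypoClass_append, ih s hs ht',
        ← hypoClass_append]
      simp [List.replicate_succ']
    · have hclt : c < m := ((ht c (by simp)).resolve_left hcm).1
      have := ih (s ++ [c])
        (by intro d hd; simp at hd; rcases hd with hd | rfl; exacts [hs d hd, hclt.le])
        (fun d hd => (ht d (by simp [hd])).imp_right fun ⟨h, z, hz, h'⟩ =>
          ⟨h, z, by simp [hz], h'⟩)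
      simpa [hcm] using this

lemma pair_sublist_cons_iff {α : Type*} (i j a : α) (w : List α) :
    [j, i].Sublist (a :: w) ↔ (a = j ∧ i ∈ w) ∨ [j, i].Sublist w := by
  rw [List.sublist_cons_iff]
  constructor
  · rintro (h | ⟨r, hr, h⟩)
    · exact .inr h
    · cases hr
      exact .inl ⟨rfl, by simpa using h⟩
  · rintro (⟨rfl, h⟩ | h)
    · exact .inr ⟨[i], rfl, by simpa using h⟩
    · exact .inl h

lemma pair_sublist_append_iff {α : Type*} (i j : α) (u v : List α) :
    [j, i].Sublist (u ++ v) ↔ [j, i].Sublist u ∨ [j, i].Sublist v ∨ (j ∈ u ∧ i ∈ v) := by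
  induction u with
  | nil => simp
  | cons a u ih =>
    rw [List.cons_append, pair_sublist_cons_iff, pair_sublist_cons_iff, ih]
    simp only [List.mem_append, List.mem_cons]
    grind

/-- If the two largest letters `l < m` of a word have no inversion, the occurrences of `m` can be
collected at the end. -/
lemma hypoClass_eq_of_not_inversion (w : List Alph) (l m : Alph) (hlm : l < m)
    (hw : ∀ c ∈ w, c = m ∨ c ≤ l) (hl : l ∈ w) (hinv : ¬ [m, l].Sublist w) :
    hypoClass w = hypoClass (w.filter (· ≠ m) ++ List.replicate (w.count m) m) := by
  obtain ⟨s, l', t, rfl, ht, rfl⟩ := exists_last_split (fun c => c = l) w ⟨l, hl, rfl⟩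
  have hms : m ∉ s := fun hm => hinv ((pair_sublist_append_iff _ _ _ _).2
    (.inr (.inr ⟨hm, by simp⟩)))
  have hc := hypoClass_collect_max (s ++ [l']) t m
    (by intro c hc; rcases hw c (by simp at hc ⊢; tauto) with h | h; exacts [h.le, h.trans hlm.le])
    (by
      intro c hc
      refine (hw c (by simp [hc])).imp_right fun h => ⟨h.trans_lt hlm, l', by simp, ?_⟩
      exact lt_of_le_of_ne h (ht c hc))
  have hfs : s.filter (· ≠ m) = s := List.filter_eq_self.2 (by
    intro a ha; simpa using fun h : a = m => hms (h ▸ ha))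
  have hcs : s.count m = 0 := List.count_eq_zero.2 hms
  have e₁ : (s ++ l' :: t).filter (· ≠ m) = s ++ [l'] ++ t.filter (· ≠ m) := by
    rw [List.filter_append, hfs]; simp [hlm.ne]
  have e₂ : (s ++ l' :: t).count m = t.count m := by simp [hcs, hlm.ne]
  rw [e₁, e₂, ← hc]
  simp

/-- If the two largest letters `l < m` of a word have an inversion, one occurrence of `m` can be
moved to the front and the others can be collected at the end. -/
lemma hypoClass_eq_of_inversion (w : List Alph) (l m : Alph) (hlm : l < m)
    (hw : ∀ c ∈ w, c = m ∨ c ≤ l) (hinv : [m, l].Sublist w) :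
    hypoClass w =
      hypoClass (m :: (w.filter (· ≠ m) ++ List.replicate (w.count m - 1) m)) := by
  obtain ⟨s, m', t, rfl, hs, rfl⟩ := exists_first_split (fun c => c = m) w
    ⟨m, hinv.subset (by simp), rfl⟩
  have hms : m' ∉ s := fun h => hs _ h rfl
  have hle : ∀ c ∈ s ++ m' :: t, c ≤ m' := fun c hc => by
    rcases hw c hc with h | h; exacts [h.le, h.trans hlm.le]
  have hlt : l ∈ t := by
    rcases (pair_sublist_append_iff _ _ _ _).1 hinv with h | h | h
    · exact absurd (h.subset (by simp)) hms
    · rcases (pair_sublist_cons_iff _ _ _ _).1 h with h | h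
      · exact h.2
      · exact h.subset (by simp)
    · simpa [hlm.ne] using h.2
  have hc := hypoClass_collect_max (s ++ [m']) t m'
    (fun c hc => hle c (by simp at hc ⊢; tauto))
    (by
      intro c hc
      by_cases h : c = m'
      · exact .inl h
      · have := lt_of_le_of_ne (hle c (by simp [hc])) h
        exact .inr ⟨this, m', by simp, this⟩)
  have hfs : s.filter (· ≠ m') = s := List.filter_eq_self.2 (by
    intro a ha; simpa using fun h : a = m' => hms (h ▸ ha))
  have hcs : s.count m' = 0 := List.count_eq_zero.2 hms
  have hmove := hypoClass_move_max_left s (t.filter (· ≠ m')) m' l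
    (by
      intro c hc
      simp at hc
      exact lt_of_le_of_ne (hle c (by simp [hc.1])) hc.2)
    (by simp [hlt, hlm.ne])
    (fun c hc => (hw c (by simp [hc])).resolve_left (hs c hc))
  have e₁ : s ++ m' :: t = s ++ [m'] ++ t := by simp
  have e₂ : s ++ [m'] ++ t.filter (· ≠ m') = s ++ m' :: t.filter (· ≠ m') := by simp
  have e₃ : (s ++ m' :: t).filter (· ≠ m') = s ++ t.filter (· ≠ m') := by
    rw [List.filter_append, hfs]; simp
  have e₄ : (s ++ m' :: t).count m' - 1 = t.count m' := by simp [hcs]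
  rw [e₃, e₄, e₁, hc, hypoClass_append, e₂, hmove, ← hypoClass_append]
  rfl

lemma pair_sublist_filter_iff {α : Type*} (p : α → Bool) (i j : α) (hi : p i) (hj : p j)
    (w : List α) : [j, i].Sublist (w.filter p) ↔ [j, i].Sublist w := by
  refine ⟨fun h => h.trans List.filter_sublist, fun h => ?_⟩
  simpa [hi, hj] using h.filter p

lemma exists_max_mem (w : List Alph) (h : w ≠ []) : ∃ m ∈ w, ∀ c ∈ w, c ≤ m := by
  obtain ⟨m, hm, hmax⟩ := w.toFinset.exists_max_image id (by simpa using h)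
  exact ⟨m, by simpa using hm, fun c hc => hmax c (by simpa using hc)⟩

/-- Two words with the same content and the same inversions between consecutive letters of their
support have the same class in `hypo`. -/
lemma hypoClass_eq_of_invariants (u v : List Alph) (hcount : ∀ c, u.count c = v.count c)
    (hinv : ∀ i j, i < j → i ∈ u → j ∈ u → (∀ c ∈ u, c ≤ i ∨ j ≤ c) →
      ([j, i].Sublist u ↔ [j, i].Sublist v)) :
    hypoClass u = hypoClass v := by
  induction hn : u.length using Nat.strong_induction_on generalizing u v with
  | _ n ih =>
  have hmem : ∀ c, c ∈ u ↔ c ∈ v := fun c => by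
    rw [← List.count_pos_iff, ← List.count_pos_iff, hcount]
  by_cases hu : u = []
  · subst hu
    have : v = [] := List.eq_nil_iff_forall_not_mem.2 fun c hc => by simpa using (hmem c).2 hc
    rw [this]
  obtain ⟨m, hmu, hm⟩ := exists_max_mem u hu
  have hfil : hypoClass (u.filter (· ≠ m)) = hypoClass (v.filter (· ≠ m)) := by
    refine ih (u.filter (· ≠ m)).length ?_ _ _ ?_ ?_ rfl
    · rw [← hn]
      exact List.length_filter_lt_length_iff_exists.2 ⟨m, hmu, by simp⟩
    · intro c
      by_cases hc : c = m
      · rw [List.count_eq_zero.2 (by simp [hc]), List.count_eq_zero.2 (by simp [hc])]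
      · rw [List.count_filter (by simpa using hc), List.count_filter (by simpa using hc), hcount]
    · intro i j hij hi hj hcons
      simp only [List.mem_filter, ne_eq, decide_not, Bool.not_eq_true', decide_eq_false_iff_not]
        at hi hj hcons
      rw [pair_sublist_filter_iff _ _ _ (by simpa using hi.2) (by simpa using hj.2),
        pair_sublist_filter_iff _ _ _ (by simpa using hi.2) (by simpa using hj.2)]
      refine hinv i j hij hi.1 hj.1 fun c hc => ?_
      by_cases h : c = m
      · exact .inr (h ▸ hm j hj.1)
      · exact hcons c ⟨hc, h⟩
  by_cases hf : u.filter (· ≠ m) = []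
  · have hall : ∀ c ∈ u, c = m := by simpa using hf
    have h₁ : u = List.replicate (u.count m) m :=
      List.eq_replicate_iff.2 ⟨(List.count_eq_length.2 fun c hc => (hall c hc).symm).symm, hall⟩
    have hall' : ∀ c ∈ v, c = m := fun c hc => hall c ((hmem c).2 hc)
    have h₂ : v = List.replicate (v.count m) m :=
      List.eq_replicate_iff.2 ⟨(List.count_eq_length.2 fun c hc => (hall' c hc).symm).symm, hall'⟩
    rw [h₁, h₂, hcount]
  · obtain ⟨l, hlf, hl⟩ := exists_max_mem _ hf
    simp only [List.mem_filter, ne_eq, decide_not, Bool.not_eq_true', decide_eq_false_iff_not]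
      at hlf hl
    have hlm : l < m := lt_of_le_of_ne (hm l hlf.1) hlf.2
    have hwu : ∀ c ∈ u, c = m ∨ c ≤ l := fun c hc => by
      by_cases h : c = m
      · exact .inl h
      · exact .inr (hl c ⟨hc, h⟩)
    have hwv : ∀ c ∈ v, c = m ∨ c ≤ l := fun c hc => hwu c ((hmem c).2 hc)
    have hiff := hinv l m hlm hlf.1 hmu fun c hc => (hwu c hc).symm.imp_right fun h => h.ge
    by_cases h : [m, l].Sublist u
    · rw [hypoClass_eq_of_inversion u l m hlm hwu h,
        hypoClass_eq_of_inversion v l m hlm hwv (hiff.1 h), hypoClass_cons, hypoClass_cons,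
        hypoClass_append, hypoClass_append, hfil, hcount]
    · rw [hypoClass_eq_of_not_inversion u l m hlm hwu hlf.1 h,
        hypoClass_eq_of_not_inversion v l m hlm hwv ((hmem l).1 hlf.1) (fun h' => h (hiff.2 h')),
        hypoClass_append, hypoClass_append, hfil, hcount]

/-- The congruence identifying words with equally many letters `i` and `j` and the same inversion
between these two letters. -/
def inversionCon (i j : Alph) : Con (FreeMonoid Alph) where
  r u v := u.toList.count i = v.toList.count i ∧ u.toList.count j = v.toList.count j ∧
    ([j, i].Sublist u.toList ↔ [j, i].Sublist v.toList)
  iseqv := ⟨fun _ => ⟨rfl, rfl, Iff.rfl⟩, fun h => ⟨h.1.symm, h.2.1.symm, h.2.2.symm⟩,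
    fun h h' => ⟨h.1.trans h'.1, h.2.1.trans h'.2.1, h.2.2.trans h'.2.2⟩⟩
  mul' := by
    rintro a b c d ⟨h₁, h₂, h₃⟩ ⟨k₁, k₂, k₃⟩
    refine ⟨by simp [h₁, k₁], by simp [h₂, k₂], ?_⟩
    rw [toList_mul, toList_mul, pair_sublist_append_iff, pair_sublist_append_iff, h₃, k₃,
      ← List.count_pos_iff, ← List.count_pos_iff, h₂, k₁, List.count_pos_iff,
      List.count_pos_iff]

lemma hypoCon_le_inversionCon (i j : Alph) (hij : i < j) (hcov : ∀ c, c ≤ i ∨ j ≤ c) :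
    hypoCon ≤ inversionCon i j := by
  refine Con.conGen_le.2 ?_
  rintro u v (⟨a, b, c, h₁, h₂, rfl, rfl⟩ | ⟨a, b, c, h₁, h₂, rfl, rfl⟩ |
    ⟨a, b, c, d, h₁, h₂, h₃, rfl, rfl⟩ | ⟨a, b, c, d, h₁, h₂, h₃, rfl, rfl⟩) <;>
  · refine ⟨?_, ?_, ?_⟩
    · simp [List.count_cons]; ring
    · simp [List.count_cons]; ring
    · have ha := hcov a
      have hb := hcov b
      have hc := hcov c
      simp [pair_sublist_cons_iff]
      grind

/-- A monoid presented as a quotient of a free monoid satisfies an identity iff all substitutions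
of words for the variables give congruent words. -/
lemma mSatisfies_quotient_iff {A X : Type*} (c : Con (FreeMonoid A)) (u v : FreeMonoid X) :
    MSatisfies c.Quotient u v ↔ ∀ σ : FreeMonoid X →* FreeMonoid A, c (σ u) (σ v) := by
  constructor
  · intro h σ
    exact (Con.eq c).1 (h (c.mk'.comp σ))
  · intro h ψ
    obtain ⟨f, hf⟩ : ∃ f : X → FreeMonoid A, ∀ x, c.mk' (f x) = ψ (of x) :=
      ⟨fun x => (Con.mk'_surjective (ψ (of x))).choose,
        fun x => (Con.mk'_surjective (ψ (of x))).choose_spec⟩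
    have hψ : ψ = c.mk'.comp (FreeMonoid.lift f) := FreeMonoid.hom_eq fun x => by
      rw [MonoidHom.comp_apply, FreeMonoid.lift_eval_of, hf]
    rw [hψ]
    exact (Con.eq c).2 (h _)

/-- The homomorphism sending `i` to `p`, `j` to `q` and erasing all other letters. -/
def pairProj {B : Type*} (i j : Alph) (p q : B) : FreeMonoid Alph →* FreeMonoid B :=
  FreeMonoid.lift fun a => if a = i then of p else if a = j then of q else 1

lemma map_comp_pairProj {B C : Type*} (f : B → C) (i j : Alph) (p q : B) :
    (FreeMonoid.map f).comp (pairProj i j p q) = pairProj i j (f p) (f q) := by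
  refine FreeMonoid.hom_eq fun a => ?_
  simp only [pairProj, MonoidHom.comp_apply, FreeMonoid.lift_eval_of]
  split_ifs <;> simp

lemma toList_pairProj_cons (i j : Alph) {B : Type*} (p q : B) (a : Alph) (w : List Alph) :
    (pairProj i j p q (ofList (a :: w))).toList =
      (if a = i then [p] else if a = j then [q] else []) ++
        (pairProj i j p q (ofList w)).toList := by
  rw [ofList_cons, map_mul, toList_mul]
  congr 1

lemma count_pairProj {B : Type*} [DecidableEq B] (i j : Alph) (p q : B) (hpq : p ≠ q)
    (w : List Alph) : (pairProj i j p q (ofList w)).toList.count p = w.count i := by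
  induction w with
  | nil => simp
  | cons a w ih =>
    rw [toList_pairProj_cons, List.count_append, ih, List.count_cons]
    split_ifs <;> simp_all [Nat.add_comm, hpq.symm]

lemma pair_sublist_pairProj_iff {B : Type*} [DecidableEq B] (i j : Alph) (hij : i ≠ j) (p q : B)
    (hpq : p ≠ q) (w : List Alph) :
    [q, p].Sublist (pairProj i j p q (ofList w)).toList ↔ [j, i].Sublist w := by
  induction w with
  | nil => simp
  | cons a w ih =>
    have hmem : p ∈ (pairProj i j p q (ofList w)).toList ↔ i ∈ w := by
      rw [← List.count_pos_iff, count_pairProj i j p q hpq, List.count_pos_iff]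
    rw [toList_pairProj_cons, pair_sublist_cons_iff]
    split_ifs with h₁ h₂
    · simp [pair_sublist_cons_iff, ih, h₁, hij, hpq]
    · rw [List.singleton_append, pair_sublist_cons_iff, ih, hmem]
      simp [h₂]
    · simp [ih, h₂]

/-- For every `n ≥ 2`, the monoids `hypo` and `hypo_n` satisfy exactly the same
identities: an identity `u ≈ v` over any alphabet of variables `X` holds in `hypo`
if and only if it holds in `hypo_n`. -/
theorem hypo_hypoN_same_identities (n : ℕ) (hn : 2 ≤ n) {X : Type*}
    (u v : FreeMonoid X) :
    MSatisfies Hypo u v ↔ MSatisfies (HypoN n) u v := by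
  rw [mSatisfies_quotient_iff, mSatisfies_quotient_iff]
  refine ⟨fun h σ => h ((inclN n).comp σ), fun h σ => ?_⟩
  let one : AlphN n := ⟨1, by simpa using by omega⟩
  let two : AlphN n := ⟨2, by simpa using hn⟩
  have hne : (1 : Alph) ≠ 2 := by decide
  have key : ∀ i j, inversionCon 1 2 (pairProj i j 1 2 (σ u)) (pairProj i j 1 2 (σ v)) := by
    intro i j
    have hcon : hypoCon (inclN n (pairProj i j one two (σ u)))
        (inclN n (pairProj i j one two (σ v))) := h ((pairProj i j one two).comp σ)
    have hmap : ∀ w, inclN n (pairProj i j one two w) = pairProj i j 1 2 w := fun w =>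
      DFunLike.congr_fun (map_comp_pairProj Subtype.val i j one two) w
    rw [hmap, hmap] at hcon
    refine hypoCon_le_inversionCon 1 2 (by decide) (fun c => ?_) hcon
    rw [or_iff_not_imp_left, not_le]
    exact fun hc => PNat.add_one_le_iff.2 hc
  refine (Con.eq hypoCon).1 (hypoClass_eq_of_invariants (σ u).toList (σ v).toList
    (fun i => ?_) fun i j hij _ _ _ => ?_)
  · have := (key i i).1
    rwa [← ofList_toList (σ u), ← ofList_toList (σ v), count_pairProj i i 1 2 hne,
      count_pairProj i i 1 2 hne] at this
  · have := (key i j).2.2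
    rwa [← ofList_toList (σ u), ← ofList_toList (σ v),
      pair_sublist_pairProj_iff i j hij.ne 1 2 hne,
      pair_sublist_pairProj_iff i j hij.ne 1 2 hne] at this
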